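/- arXiv:0711.0879 — 2 statements merged into one kernel-verified Lean document; each statement's English description precedes it below -/
import Mathlib

section
/- Under assumptions (A1)–(A2) (V has a non-degenerate global maximum E₀ at 0 and the trapped set of p at energy E₀ is {(0,0)}), the set L = {x ≠ 0 : V(x) ≥ E₀} is empty; that is, V(x) < E₀ for all x ≠ 0, so the maximum at 0 is strict and global. -/
open Filter

section

open scoped NNReal Manifold ContDiff

/-- A globally Lipschitz `C¹` vector field has global integral curves. -/
theorem LipschitzWith.exists_global_hasDerivAt {G : Type*} [NormedAddCommGroup G]
    [NormedSpace ℝ G] [CompleteSpace G] {f : G → G} {K : ℝ≥0} (hK : LipschitzWith K f)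
    (hf : ContDiff ℝ 1 f) (p : G) :
    ∃ γ : ℝ → G, γ 0 = p ∧ ∀ t, HasDerivAt γ (f (γ t)) t := by
  let v : (x : G) → TangentSpace 𝓘(ℝ, G) x := f
  have hv : CMDiff 1 (fun x : G ↦ (⟨x, v x⟩ : TangentBundle 𝓘(ℝ, G) G)) :=
    contMDiff_vectorSpace_iff_contDiff.2 hf
  obtain ⟨ε, hεdef⟩ : ∃ ε : ℝ, ε = 1 / (1 + K) := ⟨_, rfl⟩
  have hε : 0 < ε := by rw [hεdef]; positivity
  have key : ∀ q : G, ∃ γ : ℝ → G, γ 0 = q ∧ IsMIntegralCurveOn γ v (Set.Ioo (-ε) ε) := by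
    intro q
    have hpl : IsPicardLindelof (fun _ ↦ f) (tmin := -ε) (tmax := ε)
        ⟨0, by simp [hε.le]⟩ q (‖f q‖₊ + 1) 0 (‖f q‖₊ + K * (‖f q‖₊ + 1)) K := by
      refine .of_time_independent (fun x hx => ?_) hK.lipschitzOnWith ?_
      · have h1 := hK.dist_le_mul x q
        rw [dist_eq_norm] at h1
        have h2 : dist x q ≤ ‖f q‖ + 1 := by simpa using hx
        have h3 := norm_add_le (f x - f q) (f q)
        rw [sub_add_cancel] at h3
        have h4 := mul_le_mul_of_nonneg_left h2 K.coe_nonneg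
        push_cast
        linarith
      · have h0 : 0 ≤ (K : ℝ) := K.coe_nonneg
        have h1 := norm_nonneg (f q)
        simp only [sub_zero, zero_sub, neg_neg, max_self, hεdef]
        push_cast
        rw [mul_one_div, div_le_iff₀ (by positivity)]
        nlinarith
    obtain ⟨γ, h0, hγ⟩ := hpl.exists_eq_forall_mem_Icc_hasDerivWithinAt₀
    refine ⟨γ, h0, fun t ht => ?_⟩
    exact ((hγ t (Set.Ioo_subset_Icc_self ht)).mono
      Set.Ioo_subset_Icc_self).hasFDerivWithinAt.hasMFDerivWithinAt
  obtain ⟨γ, h0, hγ⟩ := exists_isMIntegralCurve_of_isMIntegralCurveOn hv hε key p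
  refine ⟨γ, h0, fun t => ?_⟩
  have : HasFDerivAt γ ((1 : ℝ →L[ℝ] ℝ).smulRight (f (γ t))) t := (hγ t).hasFDerivAt
  simpa using this.hasDerivAt

/-- The discrete action of the first `N` steps of a path `y` with time step `h`,
for the Lagrangian `‖v‖² / 2 + Φ(x)`. -/
noncomputable def discreteAction {E : Type*} [NormedAddCommGroup E] (Φ : E → ℝ) (h : ℝ) (N : ℕ)
    (y : ℕ → E) : ℝ :=
  ∑ i ∈ Finset.range N, (‖y (i + 1) - y i‖ ^ 2 / (2 * h) + h * Φ (y i))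

/-- Discrete paths in the closed ball of radius `R` which start in `L` and rest at the origin
from time `N` on. -/
def discretePaths {E : Type*} [NormedAddCommGroup E] (L : Set E) (R : ℝ) (N : ℕ) :
    Set (ℕ → E) :=
  {y | (∀ i, ‖y i‖ ≤ R) ∧ y 0 ∈ L ∧ ∀ i, N ≤ i → y i = 0}

section

variable {E : Type*} [NormedAddCommGroup E] {Φ : E → ℝ} {L : Set E} {R h : ℝ} {N : ℕ}

theorem isCompact_discretePaths [ProperSpace E] (hL : IsClosed L) (R : ℝ) (N : ℕ) :
    IsCompact (discretePaths L R N) := by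
  have h1 : IsCompact (Set.univ.pi fun _ : ℕ => Metric.closedBall (0 : E) R) :=
    isCompact_univ_pi fun _ => isCompact_closedBall 0 R
  have h2 : IsClosed ((fun y : ℕ → E => y 0) ⁻¹' L ∩
      ⋂ i, ⋂ _ : N ≤ i, (fun y : ℕ → E => y i) ⁻¹' {0}) :=
    (hL.preimage (continuous_apply 0)).inter <| isClosed_iInter fun i => isClosed_iInter fun _ =>
      isClosed_singleton.preimage (continuous_apply i)
  convert h1.inter_right h2 using 1
  ext y
  simp [discretePaths]

theorem continuous_discreteAction (hΦ : Continuous Φ) (h : ℝ) (N : ℕ) :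
    Continuous (discreteAction Φ h N) := by
  unfold discreteAction
  fun_prop

theorem discreteAction_shift_le (hΦ : ∀ x, 0 ≤ Φ x) (hΦ0 : Φ 0 = 0) (hh : 0 < h) {y : ℕ → E}
    (hy : ∀ i, N ≤ i → y i = 0) (j : ℕ) :
    discreteAction Φ h N (fun i => y (i + j)) ≤ discreteAction Φ h N y := by
  have hnn : ∀ i, 0 ≤ ‖y (i + 1) - y i‖ ^ 2 / (2 * h) + h * Φ (y i) := fun i => by
    have := hΦ (y i)
    positivity
  have hz : ∀ i, N ≤ i → ‖y (i + 1) - y i‖ ^ 2 / (2 * h) + h * Φ (y i) = 0 := fun i hi => by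
    simp [hy i hi, hy (i + 1) (by omega), hΦ0]
  have h1 : discreteAction Φ h N (fun i => y (i + j)) =
      ∑ i ∈ Finset.Ico j (N + j), (‖y (i + 1) - y i‖ ^ 2 / (2 * h) + h * Φ (y i)) := by
    rw [Finset.sum_Ico_eq_sum_range, Nat.add_sub_cancel]
    refine Finset.sum_congr rfl fun i _ => ?_
    simp only [show i + 1 + j = j + i + 1 by ring, show i + j = j + i by ring]
  have h2 : discreteAction Φ h N y =
      ∑ i ∈ Finset.range (N + j), (‖y (i + 1) - y i‖ ^ 2 / (2 * h) + h * Φ (y i)) := by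
    refine Finset.sum_subset (Finset.range_mono (by omega)) fun i _ hi => hz i ?_
    simpa using hi
  rw [h1, h2]
  refine Finset.sum_le_sum_of_subset_of_nonneg (fun i hi => ?_) fun i _ _ => hnn i
  simp at hi ⊢
  omega

/-- An action minimizer can be chosen to visit `L` only at its starting point. -/
theorem exists_minimizer_discreteAction [ProperSpace E] (hL : IsClosed L) (hL0 : (0 : E) ∉ L)
    (hΦc : Continuous Φ) (hΦ : ∀ x, 0 ≤ Φ x) (hΦ0 : Φ 0 = 0) (hh : 0 < h)
    (hne : (discretePaths L R N).Nonempty) :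
    ∃ y ∈ discretePaths L R N, (∀ i, y (i + 1) ∉ L) ∧
      ∀ z ∈ discretePaths L R N, discreteAction Φ h N y ≤ discreteAction Φ h N z := by
  obtain ⟨y, hy, hmin⟩ := (isCompact_discretePaths hL R N).exists_isMinOn hne
    (continuous_discreteAction hΦc h N).continuousOn
  have hex : ∃ j, y j ∈ L ∧ ∀ i, j < i → y i ∉ L := by
    classical
    refine ⟨Nat.findGreatest (fun j => y j ∈ L) N,
      Nat.findGreatest_spec (P := fun j => y j ∈ L) (Nat.zero_le N) hy.2.1, fun i hi hiL => ?_⟩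
    rcases le_or_gt i N with hiN | hiN
    · exact Nat.findGreatest_is_greatest hi hiN hiL
    · exact hL0 (hy.2.2 i hiN.le ▸ hiL)
  obtain ⟨j, hj, hj'⟩ := hex
  refine ⟨fun i => y (i + j), ⟨fun i => hy.1 _, by simpa using hj,
    fun i hi => hy.2.2 _ (by omega)⟩, fun i => hj' _ (by omega), fun z hz => ?_⟩
  exact (discreteAction_shift_le hΦ hΦ0 hh hy.2.2 j).trans (hmin hz)

/-- Paths of bounded action stay in a bounded region, if `Φ` is bounded below at infinity. -/
theorem norm_le_of_discreteAction_le (hΦ : ∀ x, 0 ≤ Φ x) (hh : 0 < h) {y : ℕ → E} {A R₀ c : ℝ}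
    (hR₀ : 0 ≤ R₀) (hc : 0 < c) (hΦR : ∀ x, R₀ < ‖x‖ → c ^ 2 / 2 ≤ Φ x)
    (hy : ∀ i, N ≤ i → y i = 0) (hA : discreteAction Φ h N y ≤ A) (i : ℕ) :
    ‖y i‖ ≤ R₀ + A / c := by
  set g : ℕ → ℝ := fun i => max (‖y i‖ - R₀) 0 with hg
  have hnn : ∀ i, 0 ≤ ‖y (i + 1) - y i‖ ^ 2 / (2 * h) + h * Φ (y i) := fun i => by
    have := hΦ (y i)
    positivity
  have hstep : ∀ i, c * (g i - g (i + 1)) ≤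
      ‖y (i + 1) - y i‖ ^ 2 / (2 * h) + h * Φ (y i) := by
    intro i
    rcases le_or_gt (g i) (g (i + 1)) with hle | hlt
    · exact (mul_nonpos_of_nonneg_of_nonpos hc.le (by linarith)).trans (hnn i)
    · have hpos : 0 < g i := (le_max_right _ _).trans_lt hlt
      have hgi : g i = ‖y i‖ - R₀ := by
        rcases max_choice (‖y i‖ - R₀) 0 with h1 | h1
        · exact h1
        · exact absurd (h1 ▸ hpos : (0 : ℝ) < 0) (lt_irrefl _)
      have h1 := hΦR (y i) (by linarith)
      have h2 : ‖y (i + 1)‖ - R₀ ≤ g (i + 1) := le_max_left _ _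
      have h3 : ‖y i‖ - ‖y (i + 1)‖ ≤ ‖y (i + 1) - y i‖ := by
        rw [norm_sub_rev]; exact norm_sub_norm_le _ _
      have h4 : c * (g i - g (i + 1)) ≤ c * ‖y (i + 1) - y i‖ := by gcongr; linarith
      have h5 : h * (c ^ 2 / 2) ≤ h * Φ (y i) := by gcongr
      have h6 : c * ‖y (i + 1) - y i‖ ≤ ‖y (i + 1) - y i‖ ^ 2 / (2 * h) + h * (c ^ 2 / 2) := by
        rw [div_add' _ _ _ (by positivity), le_div_iff₀ (by positivity)]
        nlinarith [sq_nonneg (‖y (i + 1) - y i‖ - c * h)]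
      linarith
  have hA0 : 0 ≤ discreteAction Φ h N y := Finset.sum_nonneg fun i _ => hnn i
  rcases le_or_gt N i with hi | hi
  · rw [hy i hi, norm_zero]
    have := div_nonneg (hA0.trans hA) hc.le
    linarith
  · have h1 : c * (g i - g N) ≤ discreteAction Φ h N y := by
      have h1 : c * (g i - g N) = ∑ j ∈ Finset.Ico i N, c * (g j - g (j + 1)) := by
        have h0 := Finset.sum_Ico_sub g hi.le
        rw [← Finset.mul_sum, ← neg_sub, ← h0, ← Finset.sum_neg_distrib]
        simp
      rw [h1]
      refine (Finset.sum_le_sum fun j _ => hstep j).trans ?_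
      refine Finset.sum_le_sum_of_subset_of_nonneg (fun j hj => ?_) fun j _ _ => hnn j
      simp at hj ⊢
      omega
    have h2 : g N = 0 := by simp [hg, hy N le_rfl, hR₀]
    have h3 : ‖y i‖ - R₀ ≤ g i := le_max_left _ _
    have h4 : g i ≤ A / c := by
      rw [le_div_iff₀ hc, mul_comm]
      rw [h2, sub_zero] at h1
      linarith
    linarith

end

section

variable {E : Type*} [NormedAddCommGroup E] [InnerProductSpace ℝ E] {Φ : E → ℝ} {L : Set E}
  {R h : ℝ} {N : ℕ}

/-- The discrete Euler–Lagrange equation. -/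
theorem discrete_euler_lagrange [CompleteSpace E] (hh : 0 < h) {y : ℕ → E}
    (hy : y ∈ discretePaths L R N)
    (hmin : ∀ z ∈ discretePaths L R N, discreteAction Φ h N y ≤ discreteAction Φ h N z)
    {i : ℕ} (hi : i + 1 < N) (hR : ‖y (i + 1)‖ < R) {g : E} (hg : HasGradientAt Φ g (y (i + 1))) :
    y (i + 2) - y (i + 1) = y (i + 1) - y i + h ^ 2 • g := by
  set q : E → ℝ := fun u => (2 * h)⁻¹ * ‖u - y i‖ ^ 2 + ((2 * h)⁻¹ * ‖u - y (i + 2)‖ ^ 2 + h * Φ u)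
    with hq
  have hdiff : ∀ u, discreteAction Φ h N (Function.update y (i + 1) u) - discreteAction Φ h N y =
      q u - q (y (i + 1)) := by
    intro u
    unfold discreteAction
    rw [← Finset.sum_sub_distrib, ← Finset.sum_subset (s₁ := {i, i + 1})]
    · rw [Finset.sum_pair (by omega)]
      simp [hq, norm_sub_rev (y (i + 2))]
      ring
    · intro j hj
      simp at hj ⊢
      omega
    · intro j _ hj
      simp at hj
      rw [Function.update_of_ne (by omega), Function.update_of_ne (by omega), sub_self]
  have hloc : IsLocalMin q (y (i + 1)) := by
    have hev : ∀ᶠ u in nhds (y (i + 1)), ‖u‖ < R :=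
      continuous_norm.continuousAt.eventually_lt continuousAt_const hR
    filter_upwards [hev] with u hu
    have hmem : Function.update y (i + 1) u ∈ discretePaths L R N := by
      refine ⟨fun j => ?_, ?_, fun j hj => ?_⟩
      · rcases eq_or_ne j (i + 1) with rfl | hj
        · simpa using hu.le
        · simpa [Function.update_of_ne hj] using hy.1 j
      · simpa [Function.update_of_ne (show 0 ≠ i + 1 by omega)] using hy.2.1
      · rw [Function.update_of_ne (by omega)]
        exact hy.2.2 j hj
    linarith [hdiff u, hmin _ hmem]
  have hder := ((((hasFDerivAt_id (𝕜 := ℝ) (y (i + 1))).sub_const (y i)).norm_sq.const_mul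
    (2 * h)⁻¹).add ((((hasFDerivAt_id (𝕜 := ℝ) (y (i + 1))).sub_const (y (i + 2))).norm_sq.const_mul
    (2 * h)⁻¹).add (hg.hasFDerivAt.const_mul h)))
  have hzero := hloc.hasFDerivAt_eq_zero hder
  refine ext_inner_right ℝ fun w => ?_
  have hw := congrArg (fun φ : E →L[ℝ] ℝ => φ w) hzero
  simp at hw
  simp only [inner_sub_left, inner_add_left, inner_smul_left, RCLike.conj_to_real]
  field_simp at hw
  linarith

/-- The straight path from `p` to the origin, traversed in unit time. -/
theorem exists_discreteAction_le {p : E} (hp : p ∈ L) (hpR : ‖p‖ ≤ R) (hΦ0 : Φ 0 = 0) {B : ℝ}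
    (hΦB : ∀ x, Φ x ≤ B) {m : ℕ} (hm : 0 < m) (hmN : m ≤ N) :
    ∃ y ∈ discretePaths L R N, discreteAction Φ (1 / m) N y ≤ ‖p‖ ^ 2 / 2 + B := by
  have hm' : (0 : ℝ) < m := by exact_mod_cast hm
  set y : ℕ → E := fun i => (((m - i : ℕ) : ℝ) / m) • p with hy
  have hzero : ∀ i, m ≤ i → y i = 0 := fun i hi => by simp [hy, Nat.sub_eq_zero_of_le hi]
  refine ⟨y, ⟨fun i => ?_, by simpa [hy, hm'.ne'] using hp,
    fun i hi => hzero i (hmN.trans hi)⟩, ?_⟩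
  · rw [hy, norm_smul, Real.norm_of_nonneg (by positivity)]
    refine le_trans (mul_le_of_le_one_left (norm_nonneg p) ?_) hpR
    rw [div_le_one hm']
    exact_mod_cast Nat.sub_le m i
  · have h1 : discreteAction Φ (1 / m) N y = discreteAction Φ (1 / m) m y := by
      refine (Finset.sum_subset (Finset.range_mono hmN) fun i _ hi => ?_).symm
      have hi' : m ≤ i := by simpa using hi
      simp [hzero i hi', hzero (i + 1) (by omega), hΦ0]
    have h2 : ∀ i ∈ Finset.range m, ‖y (i + 1) - y i‖ ^ 2 / (2 * (1 / (m : ℝ))) +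
        1 / m * Φ (y i) ≤ (‖p‖ ^ 2 / 2 + B) / m := by
      intro i hi
      have hi' : i < m := by simpa using hi
      have h3 : y (i + 1) - y i = (-(1 / (m : ℝ))) • p := by
        rw [hy, ← sub_smul]
        congr 1
        rw [Nat.cast_sub hi', Nat.cast_sub hi'.le]
        push_cast
        field_simp
        ring
      rw [h3, norm_smul, norm_neg, Real.norm_of_nonneg (by positivity)]
      have h4 : 1 / (m : ℝ) * Φ (y i) ≤ 1 / m * B := by gcongr; exact hΦB _
      refine (add_le_add_right h4 _).trans (le_of_eq ?_)
      field_simp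
    rw [h1]
    refine (Finset.sum_le_sum h2).trans (le_of_eq ?_)
    simp
    field_simp

theorem abs_sub_sub_inner_gradient_le {f : E → ℝ} {f' : E → E} {K : ℝ≥0} [CompleteSpace E]
    (hf : ∀ x, HasGradientAt f (f' x) x) (hK : LipschitzWith K f') (a b : E) :
    |f b - f a - inner ℝ (f' b) (b - a)| ≤ K * ‖b - a‖ ^ 2 := by
  have h1 := (convex_closedBall b ‖b - a‖).norm_image_sub_le_of_norm_hasFDerivWithin_le'
    (f := f) (f' := fun x => InnerProductSpace.toDual ℝ E (f' x))
    (φ := InnerProductSpace.toDual ℝ E (f' b)) (C := K * ‖b - a‖) (x := a) (y := b)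
    (fun x _ => (hf x).hasFDerivAt.hasFDerivWithinAt) (fun x hx => ?_)
    (by simp [dist_eq_norm, norm_sub_rev]) (by simp)
  · rw [Real.norm_eq_abs, InnerProductSpace.toDual_apply_apply] at h1
    linarith
  · rw [← map_sub, LinearIsometryEquiv.norm_map, ← dist_eq_norm]
    refine (hK.dist_le_mul x b).trans ?_
    gcongr
    simpa using hx

end

section

variable {E : Type*} [NormedAddCommGroup E] [InnerProductSpace ℝ E]

/-- Near-conservation of energy: along a discrete Newtonian path on which `f` is nonnegative
after the initial point, the initial energy is controlled by the average of the action. -/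
theorem discrete_energy_le {f : E → ℝ} {g : E → E} {K : ℝ}
    (hf : ∀ a b, |f b - f a - inner ℝ (g b) (b - a)| ≤ K * ‖b - a‖ ^ 2) (hK : 0 ≤ K)
    {y : ℕ → E} {h A B : ℝ} {N : ℕ} (hh : 0 < h) (hN : 0 < N)
    (hEL : ∀ i, i + 1 < N → y (i + 2) - y (i + 1) = y (i + 1) - y i + h ^ 2 • g (y (i + 1)))
    (hf0 : -f (y 0) ≤ B) (hf1 : ∀ i, 0 ≤ f (y (i + 1)))
    (hA : ∑ i ∈ Finset.range N, ‖y (i + 1) - y i‖ ^ 2 / (2 * h) ≤ A) :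
    ‖y 1 - y 0‖ ^ 2 / (2 * h ^ 2) - f (y 0) ≤ (A + h * B) / (N * h) + 2 * K * h * A := by
  set e : ℕ → ℝ := fun i => ‖y (i + 1) - y i‖ ^ 2 / (2 * h ^ 2) - f (y i) with he
  have hstep : ∀ i, i + 1 < N → e i ≤ e (i + 1) + K * ‖y (i + 1) - y i‖ ^ 2 := by
    intro i hi
    have h1 := (abs_le.1 (hf (y i) (y (i + 1)))).2
    have h2 : ‖y (i + 2) - y (i + 1)‖ ^ 2 = ‖y (i + 1) - y i‖ ^ 2 +
        2 * (h ^ 2 * inner ℝ (g (y (i + 1))) (y (i + 1) - y i)) +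
          (h ^ 2 * ‖g (y (i + 1))‖) ^ 2 := by
      rw [hEL i hi, norm_add_sq_real, inner_smul_right, real_inner_comm, norm_smul,
        Real.norm_of_nonneg (by positivity)]
    have h3 : ‖y (i + 2) - y (i + 1)‖ ^ 2 / (2 * h ^ 2) = ‖y (i + 1) - y i‖ ^ 2 / (2 * h ^ 2) +
        inner ℝ (g (y (i + 1))) (y (i + 1) - y i) + h ^ 2 * ‖g (y (i + 1))‖ ^ 2 / 2 := by
      rw [h2]
      field_simp
    have h4 : 0 ≤ h ^ 2 * ‖g (y (i + 1))‖ ^ 2 / 2 := by positivity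
    simp only [he]
    rw [show i + 1 + 1 = i + 2 by ring, h3]
    linarith
  have hsum : ∀ j, j < N → e 0 ≤ e j + K * ∑ i ∈ Finset.range j, ‖y (i + 1) - y i‖ ^ 2 := by
    intro j
    induction j with
    | zero => simp
    | succ j ih =>
      intro hj
      rw [Finset.sum_range_succ, mul_add]
      linarith [ih (by omega), hstep j hj]
  have hA' : ∑ i ∈ Finset.range N, ‖y (i + 1) - y i‖ ^ 2 ≤ 2 * h * A := by
    rw [← Finset.sum_div, div_le_iff₀ (by positivity)] at hA
    linarith
  have hle : ∀ j ∈ Finset.range N, e 0 ≤ e j + 2 * K * h * A := by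
    intro j hj
    have hj' : j < N := by simpa using hj
    have h1 : ∑ i ∈ Finset.range j, ‖y (i + 1) - y i‖ ^ 2 ≤ 2 * h * A :=
      (Finset.sum_le_sum_of_subset_of_nonneg (Finset.range_mono hj'.le)
        fun _ _ _ => by positivity).trans hA'
    have h2 := mul_le_mul_of_nonneg_left h1 hK
    linarith [hsum j hj']
  have htotal : N * e 0 ≤ (∑ j ∈ Finset.range N, e j) + N * (2 * K * h * A) := by
    have := Finset.sum_le_sum hle
    simpa [Finset.sum_add_distrib] using this
  have hpot : ∑ j ∈ Finset.range N, -f (y j) ≤ B := by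
    obtain ⟨n, rfl⟩ := Nat.exists_eq_succ_of_ne_zero hN.ne'
    rw [Finset.sum_range_succ']
    have : ∑ j ∈ Finset.range n, -f (y (j + 1)) ≤ 0 :=
      Finset.sum_nonpos fun j _ => neg_nonpos.2 (hf1 j)
    linarith
  have hkin : ∑ j ∈ Finset.range N, ‖y (j + 1) - y j‖ ^ 2 / (2 * h ^ 2) ≤ A / h := by
    rw [← Finset.sum_div, div_le_div_iff₀ (by positivity) hh]
    nlinarith
  have he' : ∑ j ∈ Finset.range N, e j ≤ A / h + B := by
    refine le_trans (le_of_eq ?_) (add_le_add hkin hpot)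
    rw [← Finset.sum_add_distrib]
    exact Finset.sum_congr rfl fun j _ => sub_eq_add_neg _ _
  have hN' : (0 : ℝ) < N := by exact_mod_cast hN
  have h5 : e 0 ≤ (A / h + B) / N + 2 * K * h * A := by
    rw [div_add' _ _ _ hN'.ne', le_div_iff₀ hN']
    linarith
  have h6 : (A / h + B) / N = (A + h * B) / (N * h) := by field_simp
  rw [h6] at h5
  exact h5

end

section

variable {E : Type*} [NormedAddCommGroup E] [NormedSpace ℝ E]

theorem norm_sub_sub_smul_le_of_hasDerivAt {γ γ' : ℝ → E} (hγ : ∀ s, HasDerivAt γ (γ' s) s)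
    {t h C : ℝ} (hh : 0 ≤ h) {w : E} (hC : ∀ s ∈ Set.Icc t (t + h), ‖γ' s - w‖ ≤ C) :
    ‖γ (t + h) - γ t - h • w‖ ≤ C * h := by
  have h1 := (convex_Icc t (t + h)).norm_image_sub_le_of_norm_hasDerivWithin_le
    (f := fun s => γ s - s • w) (f' := fun s => γ' s - w) (C := C) (x := t) (y := t + h)
    (fun s _ => by
      have h1 := ((hγ s).sub ((hasDerivAt_id s).smul_const w)).hasDerivWithinAt
        (s := Set.Icc t (t + h))
      rw [one_smul] at h1
      exact h1) hC
    (by simp [hh]) (by simp [hh])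
  rw [add_sub_cancel_left, Real.norm_of_nonneg hh] at h1
  convert h1 using 2
  rw [add_smul]
  abel

variable {F : E → E} {K : ℝ≥0} {x ξ : ℝ → E}

/-- Error estimate for the semi-implicit Euler scheme applied to `ẍ = F(x)`. -/
theorem norm_sub_discrete_le (hF : LipschitzWith K F) (hx : ∀ t, HasDerivAt x (ξ t) t)
    (hξ : ∀ t, HasDerivAt ξ (F (x t)) t) {M P τ D : ℝ} (hM : ∀ u, ‖F u‖ ≤ M)
    (hP : ∀ t ∈ Set.Icc 0 τ, ‖ξ t‖ ≤ P) (hMD : M ≤ D) (hPD : K * P ≤ D)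
    {h : ℝ} (hh : 0 < h) (hh1 : h ≤ 1) {y v : ℕ → E} {N : ℕ}
    (hy : ∀ i, y (i + 1) = y i + h • v i)
    (hv : ∀ i, i + 1 < N → v (i + 1) = v i + h • F (y (i + 1)))
    (i : ℕ) (hiN : i < N) (hiτ : i * h ≤ τ) :
    ‖x (i * h) - y i‖ + ‖ξ (i * h) - v i‖ ≤
      Real.exp ((1 + K) * (i * h)) * (‖x 0 - y 0‖ + ‖ξ 0 - v 0‖ + D * (2 + K) * (i * h * h)) := by
  have hK0 : (0 : ℝ) ≤ K := K.coe_nonneg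
  have hD : 0 ≤ D := (norm_nonneg _).trans ((hM 0).trans hMD)
  induction i with
  | zero => simp
  | succ i ih =>
    set t : ℝ := i * h with ht
    have ht0 : 0 ≤ t := by positivity
    have hth : ((i + 1 : ℕ) : ℝ) * h = t + h := by push_cast; ring
    rw [hth] at hiτ ⊢
    have ih := ih (by omega) (by linarith)
    have hξt : ∀ s ∈ Set.Icc t (t + h), ‖ξ s - ξ t‖ ≤ D * h := by
      intro s hs
      refine (convex_univ.norm_image_sub_le_of_norm_hasDerivWithin_le
        (fun u _ => (hξ u).hasDerivWithinAt) (fun u _ => (hM (x u)).trans hMD) (Set.mem_univ t)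
        (Set.mem_univ s)).trans ?_
      rw [Real.norm_of_nonneg (by linarith [hs.1])]
      gcongr
      linarith [hs.2]
    have hxt : ∀ s ∈ Set.Icc t (t + h), ‖F (x s) - F (x (t + h))‖ ≤ D * h := by
      intro s hs
      have h1 : ‖x s - x (t + h)‖ ≤ P * ‖s - (t + h)‖ :=
        (convex_Icc t (t + h)).norm_image_sub_le_of_norm_hasDerivWithin_le
          (fun u _ => (hx u).hasDerivWithinAt)
          (fun u hu => hP u ⟨by linarith [hu.1], by linarith [hu.2]⟩) (by simp [hh.le]) hs
      have hP0 : 0 ≤ P := (norm_nonneg _).trans (hP t ⟨ht0, by linarith⟩)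
      have h2 : ‖s - (t + h)‖ ≤ h := by
        rw [Real.norm_eq_abs, abs_le]
        constructor <;> linarith [hs.1, hs.2]
      rw [← dist_eq_norm]
      refine (hF.dist_le_mul _ _).trans ?_
      rw [dist_eq_norm]
      calc K * ‖x s - x (t + h)‖ ≤ K * (P * h) := by
            gcongr
            exact h1.trans (by gcongr)
        _ = K * P * h := by ring
        _ ≤ D * h := by gcongr
    have h1 := norm_sub_sub_smul_le_of_hasDerivAt hx hh.le hξt
    have h2 := norm_sub_sub_smul_le_of_hasDerivAt hξ hh.le hxt
    set a := ‖x t - y i‖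
    set b := ‖ξ t - v i‖
    set a' := ‖x (t + h) - y (i + 1)‖ with ha'
    set b' := ‖ξ (t + h) - v (i + 1)‖ with hb'
    have h3 : a' ≤ a + h * b + D * h * h := by
      have : x (t + h) - y (i + 1) =
          (x t - y i) + h • (ξ t - v i) + (x (t + h) - x t - h • ξ t) := by
        rw [hy, smul_sub]; abel
      rw [ha', this]
      refine (norm_add₃_le).trans ?_
      rw [norm_smul, Real.norm_of_nonneg hh.le]
      gcongr
    have h4 : b' ≤ b + h * (K * a') + D * h * h := by
      have : ξ (t + h) - v (i + 1) = (ξ t - v i) + h • (F (x (t + h)) - F (y (i + 1))) +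
          (ξ (t + h) - ξ t - h • F (x (t + h))) := by
        rw [hv i hiN, smul_sub]; abel
      rw [hb', this]
      refine (norm_add₃_le).trans ?_
      rw [norm_smul, Real.norm_of_nonneg hh.le]
      gcongr
      rw [← dist_eq_norm, ha', ← dist_eq_norm]
      exact hF.dist_le_mul _ _
    have ha0 : 0 ≤ a := norm_nonneg _
    have hb0 : 0 ≤ b := norm_nonneg _
    have h5 : a' ≤ a + b + D * h := by
      have e1 : h * b ≤ b := mul_le_of_le_one_left hb0 hh1
      have e2 : D * h * h ≤ D * h := mul_le_of_le_one_right (by positivity) hh1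
      linarith
    have h6 : a' + b' ≤ (1 + (1 + K) * h) * (a + b) + D * (2 + K) * (h * h) := by
      have e1 : h * (K * a') ≤ h * (K * (a + b + D * h)) := by gcongr
      have e2 : 0 ≤ h * a := by positivity
      linarith
    have h7 : 1 + (1 + K) * h ≤ Real.exp ((1 + K) * h) := by
      linarith [Real.add_one_le_exp ((1 + K) * h)]
    have h8 : Real.exp ((1 + K) * (t + h)) = Real.exp ((1 + K) * h) * Real.exp ((1 + K) * t) := by
      rw [← Real.exp_add]; ring_nf
    have h9 : 1 ≤ Real.exp ((1 + K) * (t + h)) := Real.one_le_exp (by positivity)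
    set S := ‖x 0 - y 0‖ + ‖ξ 0 - v 0‖
    calc a' + b' ≤ (1 + (1 + K) * h) * (a + b) + D * (2 + K) * (h * h) := h6
      _ ≤ Real.exp ((1 + K) * h) * (Real.exp ((1 + K) * t) * (S + D * (2 + K) * (t * h))) +
          Real.exp ((1 + K) * (t + h)) * (D * (2 + K) * (h * h)) := by
        refine add_le_add (by gcongr) (le_mul_of_one_le_left (by positivity) h9)
      _ = Real.exp ((1 + K) * (t + h)) * (S + D * (2 + K) * ((t + h) * h)) := by
        rw [h8]; ring

/-- A solution of `ẍ = F(x)` approximated, over longer and longer times, by discrete paths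
staying in a ball, stays in that ball. -/
theorem norm_le_of_discrete_approximation (hF : LipschitzWith K F)
    (hx : ∀ t, HasDerivAt x (ξ t) t) (hξ : ∀ t, HasDerivAt ξ (F (x t)) t) {M R : ℝ}
    (hM : ∀ u, ‖F u‖ ≤ M) {h : ℕ → ℝ} {N : ℕ → ℕ} {y v : ℕ → ℕ → E} (hh : ∀ k, 0 < h k)
    (hh0 : Tendsto h atTop (nhds 0)) (hN : Tendsto (fun k => N k * h k) atTop atTop)
    (hy : ∀ k i, y k (i + 1) = y k i + h k • v k i)
    (hv : ∀ k i, i + 1 < N k → v k (i + 1) = v k i + h k • F (y k (i + 1)))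
    (hR : ∀ k i, ‖y k i‖ ≤ R) (hy0 : Tendsto (fun k => y k 0) atTop (nhds (x 0)))
    (hv0 : Tendsto (fun k => v k 0) atTop (nhds (ξ 0))) {t : ℝ} (ht : 0 ≤ t) : ‖x t‖ ≤ R := by
  have hξc : Continuous ξ := continuous_iff_continuousAt.2 fun s => (hξ s).continuousAt
  have hxc : Continuous x := continuous_iff_continuousAt.2 fun s => (hx s).continuousAt
  obtain ⟨P, hP⟩ := (isCompact_Icc (a := (0 : ℝ)) (b := t)).exists_bound_of_continuousOn
    hξc.continuousOn
  set D := max M (K * P) with hD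
  have hD0 : 0 ≤ D := (norm_nonneg _).trans ((hM 0).trans (le_max_left _ _))
  set j : ℕ → ℕ := fun k => ⌊t / h k⌋₊ with hj
  have hjle : ∀ k, j k * h k ≤ t := fun k =>
    (le_div_iff₀ (hh k)).1 (Nat.floor_le (div_nonneg ht (hh k).le))
  have hjge : ∀ k, t - h k ≤ j k * h k := fun k => by
    have := (div_lt_iff₀ (hh k)).1 (Nat.lt_floor_add_one (t / h k))
    simp only [hj]
    linarith
  have hjt : Tendsto (fun k => j k * h k) atTop (nhds t) :=
    tendsto_of_tendsto_of_tendsto_of_le_of_le (by simpa using hh0.const_sub t)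
      tendsto_const_nhds hjge hjle
  have herr : Tendsto (fun k => R + Real.exp ((1 + K) * t) *
      (‖x 0 - y k 0‖ + ‖ξ 0 - v k 0‖ + D * (2 + K) * (t * h k))) atTop (nhds R) := by
    have h1 := (tendsto_const_nhds (x := x 0)).sub hy0 |>.norm
    have h2 := (tendsto_const_nhds (x := ξ 0)).sub hv0 |>.norm
    have h3 := (hh0.const_mul t).const_mul (D * (2 + K))
    simpa using (((h1.add h2).add h3).const_mul (Real.exp ((1 + K) * t))).const_add R
  refine le_of_tendsto_of_tendsto ((hxc.tendsto t).comp hjt).norm herr ?_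
  filter_upwards [hN.eventually_gt_atTop t, hh0.eventually_le_const one_pos] with k hk hk1
  have hjN : j k < N k := by
    have : (j k : ℝ) < N k := lt_of_mul_lt_mul_right ((hjle k).trans_lt hk) (hh k).le
    exact_mod_cast this
  have h1 := norm_sub_discrete_le hF hx hξ hM hP (le_max_left _ _) (le_max_right _ _)
    (hh k) hk1 (hy k) (hv k) (j k) hjN (hjle k)
  have h2 : Real.exp ((1 + K) * (j k * h k)) *
      (‖x 0 - y k 0‖ + ‖ξ 0 - v k 0‖ + D * (2 + K) * (j k * h k * h k)) ≤
      Real.exp ((1 + K) * t) * (‖x 0 - y k 0‖ + ‖ξ 0 - v k 0‖ + D * (2 + K) * (t * h k)) := by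
    have := hjle k
    have := (hh k).le
    gcongr
  have h3 : ‖x (j k * h k)‖ ≤ ‖y k (j k)‖ + ‖x (j k * h k) - y k (j k)‖ := norm_le_insert' _ _
  have h4 := norm_nonneg (ξ (j k * h k) - v k (j k))
  simp only [Function.comp_apply]
  linarith [hR k (j k)]

end

/-- A smooth function agrees on a given ball with a function whose gradient is bounded, `C¹` and
Lipschitz. -/
theorem ContDiff.exists_eventuallyEq_lipschitzWith_gradient {E : Type*} [NormedAddCommGroup E]
    [InnerProductSpace ℝ E] [FiniteDimensional ℝ E] [CompleteSpace E] {W : E → ℝ}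
    (hW : ContDiff ℝ ∞ W) {R : ℝ} (hR : 0 < R) :
    ∃ (f : E → ℝ) (g : E → E) (K : ℝ≥0) (M : ℝ), (∀ x, HasGradientAt f (g x) x) ∧
      LipschitzWith K g ∧ ContDiff ℝ 1 g ∧ (∀ x, ‖g x‖ ≤ M) ∧
      ∀ x, ‖x‖ < R → f =ᶠ[nhds x] W := by
  let χ : ContDiffBump (0 : E) := ⟨R, R + 1, hR, by linarith⟩
  set f : E → ℝ := fun x => χ x * W x with hf
  have hfc : ContDiff ℝ ∞ f := χ.contDiff.mul hW
  have hsupp : HasCompactSupport f := χ.hasCompactSupport.mul_right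
  set g : E → E := fun x => gradient f x with hg
  have hgc : ContDiff ℝ 1 g :=
    (InnerProductSpace.toDual ℝ E).symm.contDiff.comp
      ((hfc.fderiv_right (m := 1) (by norm_cast)) : ContDiff ℝ 1 (fderiv ℝ f))
  have hgs : HasCompactSupport g :=
    (hsupp.fderiv ℝ).comp_left (g := (InnerProductSpace.toDual ℝ E).symm) (map_zero _)
  obtain ⟨K, hK⟩ := ContDiff.lipschitzWith_of_hasCompactSupport hgs hgc one_ne_zero
  obtain ⟨M, hM⟩ := hgs.exists_bound_of_continuous hgc.continuous
  refine ⟨f, g, K, M, fun x => (hfc.differentiable (by simp) x).hasGradientAt, hK, hgc, hM,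
    fun x hx => ?_⟩
  filter_upwards [continuous_norm.continuousAt.eventually_lt continuousAt_const hx] with u hu
  have : χ u = 1 := χ.one_of_mem_closedBall (by simpa using hu.le)
  simp [hf, this]

/-- Discrete Newtonian paths starting in `L` with nearly minimal energy, obtained by minimizing
the discrete action among the paths from `L` to the origin. -/
theorem exists_discrete_approximation {E : Type*} [NormedAddCommGroup E] [InnerProductSpace ℝ E]
    [ProperSpace E] [CompleteSpace E] {W : E → ℝ} (hWc : Continuous W) {L : Set E}
    (hL : IsClosed L) (hL0 : (0 : E) ∉ L) (hWL : ∀ x, x ∉ L → 0 ≤ W x) (hW0 : W 0 = 0) {B : ℝ}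
    (hWB : ∀ x, |W x| ≤ B) {p : E} (hp : p ∈ L) {R₀ c : ℝ} (hpR : ‖p‖ ≤ R₀) (hc : 0 < c)
    (hWR : ∀ x, R₀ < ‖x‖ → c ^ 2 / 2 ≤ W x) {R : ℝ} (hR : R₀ + (‖p‖ ^ 2 / 2 + B) / c < R)
    {f : E → ℝ} {g : E → E} {K : ℝ≥0} (hf : ∀ x, HasGradientAt f (g x) x)
    (hg : LipschitzWith K g) (hfW : ∀ x, ‖x‖ < R → f =ᶠ[nhds x] W) {m N : ℕ} (hm : 0 < m)
    (hmN : m ≤ N) :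
    ∃ y : ℕ → E, y 0 ∈ L ∧ (∀ i, ‖y i‖ ≤ R₀ + (‖p‖ ^ 2 / 2 + B) / c) ∧
      (∀ i, i + 1 < N →
        y (i + 2) - y (i + 1) = y (i + 1) - y i + (1 / m : ℝ) ^ 2 • g (y (i + 1))) ∧
      ‖y 1 - y 0‖ ^ 2 / (2 * (1 / m : ℝ) ^ 2) - W (y 0) ≤
        (‖p‖ ^ 2 / 2 + B + 1 / m * B) / (N * (1 / m)) + 2 * K * (1 / m) * (‖p‖ ^ 2 / 2 + B) := by
  set A : ℝ := ‖p‖ ^ 2 / 2 + B with hA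
  have hB : 0 ≤ B := (abs_nonneg _).trans (hWB 0)
  have hA0 : 0 ≤ A := by positivity
  have hh : (0 : ℝ) < 1 / m := by positivity
  set Φ : E → ℝ := fun x => max (W x) 0 with hΦ
  have hΦnn : ∀ x, 0 ≤ Φ x := fun x => le_max_right _ _
  have hΦ0 : Φ 0 = 0 := by simp [hΦ, hW0]
  have hpR' : ‖p‖ ≤ R := by
    have : 0 ≤ A / c := by positivity
    linarith
  obtain ⟨z, hz, hzA⟩ := exists_discreteAction_le hp hpR' hΦ0
    (fun x => max_le ((le_abs_self _).trans (hWB x)) hB) hm hmN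
  obtain ⟨y, hy, hyL, hmin⟩ := exists_minimizer_discreteAction hL hL0 (hWc.max continuous_const)
    hΦnn hΦ0 hh ⟨z, hz⟩
  have hyA : discreteAction Φ (1 / m) N y ≤ A := (hmin z hz).trans hzA
  have hyR := norm_le_of_discreteAction_le hΦnn hh ((norm_nonneg p).trans hpR) hc
    (fun x hx => (hWR x hx).trans (le_max_left _ _)) hy.2.2 hyA
  have hyR' : ∀ i, ‖y i‖ < R := fun i => (hyR i).trans_lt hR
  have hfy : ∀ i, f (y i) = W (y i) := fun i => (hfW _ (hyR' i)).eq_of_nhds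
  have hΦf : ∀ i, Φ =ᶠ[nhds (y (i + 1))] f := fun i => by
    filter_upwards [hL.isOpen_compl.mem_nhds (hyL i), hfW _ (hyR' (i + 1))] with x hx hfx
    rw [hfx]
    exact max_eq_left (hWL x hx)
  have hEL : ∀ i, i + 1 < N →
      y (i + 2) - y (i + 1) = y (i + 1) - y i + (1 / m : ℝ) ^ 2 • g (y (i + 1)) := fun i hi =>
    discrete_euler_lagrange hh hy hmin hi (hyR' _) ((hf _).congr_of_eventuallyEq (hΦf i))
  refine ⟨y, hy.2.1, hyR, hEL, ?_⟩
  rw [← hfy 0]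
  refine discrete_energy_le (abs_sub_sub_inner_gradient_le hf hg) K.coe_nonneg hh
    (hm.trans_le hmN) hEL ?_ (fun i => ?_) ?_
  · rw [hfy]
    exact (neg_le_abs _).trans (hWB _)
  · rw [hfy]
    exact hWL _ (hyL i)
  · refine (Finset.sum_le_sum fun i _ => ?_).trans hyA
    have := hΦnn (y i)
    exact le_add_of_nonneg_right (by positivity)

/-- If `W` vanishes at the origin, is nonnegative off a closed set `L` avoiding the origin, and is
bounded below at infinity by a positive constant, then a bounded orbit of `ẍ = ∇W(x)` starts at
rest from a zero of `W` in `L`. -/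
theorem exists_bounded_newton_orbit {E : Type*} [NormedAddCommGroup E] [InnerProductSpace ℝ E]
    [FiniteDimensional ℝ E] [CompleteSpace E] {W : E → ℝ} (hW : ContDiff ℝ ∞ W) {L : Set E}
    (hL : IsClosed L) (hL0 : (0 : E) ∉ L) (hWL : ∀ x, x ∉ L → 0 ≤ W x) (hWL' : ∀ x ∈ L, W x ≤ 0)
    (hW0 : W 0 = 0) {B : ℝ} (hWB : ∀ x, |W x| ≤ B) (hne : L.Nonempty) {R₀ c : ℝ} (hc : 0 < c)
    (hWR : ∀ x, R₀ < ‖x‖ → c ^ 2 / 2 ≤ W x) :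
    ∃ (x ξ : ℝ → E) (R : ℝ), (∀ t, HasDerivAt x (ξ t) t) ∧
      (∀ t, HasDerivAt ξ (gradient W (x t)) t) ∧ x 0 ∈ L ∧ W (x 0) = 0 ∧ ξ 0 = 0 ∧
      ∀ t, ‖x t‖ ≤ R := by
  obtain ⟨p, hp⟩ := hne
  have : ProperSpace E := FiniteDimensional.proper ℝ E
  have hpR : ‖p‖ ≤ R₀ := by
    by_contra! h
    have h1 := hWR p h
    have h2 := hWL' p hp
    have : 0 < c ^ 2 / 2 := by positivity
    linarith
  have hB : 0 ≤ B := (abs_nonneg _).trans (hWB 0)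
  set A : ℝ := ‖p‖ ^ 2 / 2 + B with hA
  have hA0 : 0 ≤ A := by positivity
  set R : ℝ := R₀ + A / c with hRdef
  have hR0 : 0 ≤ R := add_nonneg ((norm_nonneg p).trans hpR) (by positivity)
  obtain ⟨f, g, K, M, hf, hgK, hg1, hgM, hfW⟩ :=
    hW.exists_eventuallyEq_lipschitzWith_gradient (R := R + 1) (by positivity)
  have hstep : ∀ k : ℕ, ∃ y : ℕ → E, y 0 ∈ L ∧ (∀ i, ‖y i‖ ≤ R) ∧
      (∀ i, i + 1 < (k + 1) ^ 3 → y (i + 2) - y (i + 1) =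
        y (i + 1) - y i + (1 / ((k + 1) ^ 2 : ℕ) : ℝ) ^ 2 • g (y (i + 1))) ∧
      ‖y 1 - y 0‖ ^ 2 / (2 * (1 / ((k + 1) ^ 2 : ℕ) : ℝ) ^ 2) - W (y 0) ≤
        (A + 1 / ((k + 1) ^ 2 : ℕ) * B) / (((k + 1) ^ 3 : ℕ) * (1 / ((k + 1) ^ 2 : ℕ))) +
          2 * K * (1 / ((k + 1) ^ 2 : ℕ)) * A := fun k =>
    exists_discrete_approximation hW.continuous hL hL0 hWL hW0 hWB hp hpR hc hWR
      (lt_add_one _) hf hgK hfW (by positivity) (Nat.pow_le_pow_right (by omega) (by norm_num))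
  choose y hyL hyR hyEL hyE using hstep
  set h : ℕ → ℝ := fun k => 1 / ((k + 1) ^ 2 : ℕ) with hhdef
  have hh : ∀ k, 0 < h k := fun k => by positivity
  have hlim : Tendsto (fun k : ℕ => 1 / ((k : ℝ) + 1)) atTop (nhds 0) :=
    tendsto_one_div_add_atTop_nhds_zero_nat
  have hheq : ∀ k : ℕ, h k = (1 / ((k : ℝ) + 1)) ^ 2 := fun k => by
    simp [hhdef]
  have hNh : ∀ k : ℕ, ((k + 1) ^ 3 : ℕ) * h k = (k : ℝ) + 1 := fun k => by
    rw [hheq]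
    push_cast
    field_simp
  have hh0 : Tendsto h atTop (nhds 0) := by
    have := hlim.pow 2
    simp only [← hheq] at this
    simpa using this
  set ε : ℕ → ℝ := fun k => (A + h k * B) * (1 / ((k : ℝ) + 1)) + 2 * K * h k * A with hε
  have hε0 : Tendsto ε atTop (nhds 0) := by
    have := (((hh0.mul_const B).const_add A).mul hlim).add ((hh0.const_mul (2 * K : ℝ)).mul_const A)
    simpa [hε] using this
  set v : ℕ → ℕ → E := fun k i => (h k)⁻¹ • (y k (i + 1) - y k i) with hv
  have hvE : ∀ k, ‖v k 0‖ ^ 2 / 2 - W (y k 0) ≤ ε k := fun k => by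
    have h1 := hyE k
    change ‖y k 1 - y k 0‖ ^ 2 / (2 * h k ^ 2) - W (y k 0) ≤
      (A + h k * B) / (((k + 1) ^ 3 : ℕ) * h k) + 2 * K * h k * A at h1
    rw [hNh] at h1
    have h2 : ‖v k 0‖ ^ 2 / 2 = ‖y k 1 - y k 0‖ ^ 2 / (2 * h k ^ 2) := by
      have := (hh k).ne'
      simp only [hv, norm_smul, norm_inv, Real.norm_of_nonneg (hh k).le, zero_add]
      field_simp
    rw [h2, hε]
    simpa [div_eq_mul_inv] using h1
  have hv0 : Tendsto (fun k => v k 0) atTop (nhds 0) := by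
    have h1 : Tendsto (fun k => ‖v k 0‖ ^ 2) atTop (nhds 0) := by
      refine squeeze_zero (fun k => by positivity) (fun k => ?_)
        (by simpa using hε0.const_mul 2 : Tendsto (fun k => 2 * ε k) atTop (nhds 0))
      linarith [hvE k, hWL' _ (hyL k)]
    have h2 := h1.sqrt
    simp only [Real.sqrt_sq (norm_nonneg _), Real.sqrt_zero] at h2
    exact tendsto_zero_iff_norm_tendsto_zero.2 h2
  obtain ⟨q, -, φ, hφ, hyq⟩ := (isCompact_closedBall (0 : E) R).tendsto_subseq
    (x := fun k => y k 0) (fun k => by simpa using hyR k 0)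
  have hqL : q ∈ L := hL.mem_of_tendsto hyq (Eventually.of_forall fun k => hyL _)
  have hWq : W q = 0 := by
    refine le_antisymm (hWL' q hqL) ?_
    have h1 : Tendsto (fun k => -ε (φ k)) atTop (nhds 0) := by
      simpa using (hε0.comp hφ.tendsto_atTop).neg
    refine le_of_tendsto_of_tendsto' h1 ((hW.continuous.tendsto q).comp hyq) fun k => ?_
    have h2 := hvE (φ k)
    have h3 : 0 ≤ ‖v (φ k) 0‖ ^ 2 / 2 := by positivity
    simp only [Function.comp_apply]
    linarith
  obtain ⟨γ, hγ0, hγ⟩ := (LipschitzWith.prodMk LipschitzWith.prod_snd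
    (hgK.comp LipschitzWith.prod_fst)).exists_global_hasDerivAt
    (contDiff_snd.prodMk (hg1.comp contDiff_fst)) (q, (0 : E))
  have hx : ∀ t, HasDerivAt (fun t => (γ t).1) (γ t).2 t := fun t => (hγ t).fst
  have hξ : ∀ t, HasDerivAt (fun t => (γ t).2) (g (γ t).1) t := fun t => (hγ t).snd
  have hbound : ∀ x ξ : ℝ → E, (∀ t, HasDerivAt x (ξ t) t) → (∀ t, HasDerivAt ξ (g (x t)) t) →
      x 0 = q → ξ 0 = 0 → ∀ t, 0 ≤ t → ‖x t‖ ≤ R := by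
    intro x ξ hx hξ hx0 hξ0 t ht
    refine norm_le_of_discrete_approximation hgK hx hξ hgM (h := fun k => h (φ k))
      (N := fun k => (φ k + 1) ^ 3) (y := fun k => y (φ k)) (v := fun k => v (φ k))
      (fun k => hh _) (hh0.comp hφ.tendsto_atTop) ?_ (fun k i => ?_) (fun k i hi => ?_)
      (fun k => hyR _) (hx0 ▸ hyq) (hξ0 ▸ hv0.comp hφ.tendsto_atTop) ht
    · simp only [hNh]
      exact tendsto_atTop_add_const_right _ _
        (tendsto_natCast_atTop_atTop.comp hφ.tendsto_atTop)
    · simp [hv, smul_smul, (hh (φ k)).ne']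
    · simp only [hv]
      rw [hyEL (φ k) i hi]
      change _ • (_ + h (φ k) ^ 2 • _) = _
      rw [smul_add, smul_smul]
      congr 2
      have := (hh (φ k)).ne'
      field_simp
  have hbdd : ∀ t, ‖(γ t).1‖ ≤ R := by
    intro t
    rcases le_total 0 t with ht | ht
    · exact hbound _ _ hx hξ (by simp [hγ0]) (by simp [hγ0]) t ht
    · have h1 := hbound (fun s => (γ (-s)).1) (fun s => -(γ (-s)).2)
        (fun s => by
          simpa [Function.comp_def] using (hx (-s)).scomp s (hasDerivAt_neg s))
        (fun s => by
          simpa [Function.comp_def, Pi.neg_def] using ((hξ (-s)).scomp s (hasDerivAt_neg s)).neg)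
        (by simp [hγ0]) (by simp [hγ0]) (-t) (by linarith)
      simpa using h1
  refine ⟨fun t => (γ t).1, fun t => (γ t).2, R, hx, fun t => ?_, by simpa [hγ0] using hqL,
    by simpa [hγ0] using hWq, by simp [hγ0], hbdd⟩
  have h1 : HasGradientAt W (g (γ t).1) (γ t).1 :=
    (hf _).congr_of_eventuallyEq (hfW _ ((hbdd t).trans_lt (lt_add_one _))).symm
  rw [h1.gradient]
  exact hξ t

end

/-- Under (A1)-(A2): V smooth short range with a non-degenerate local maximum E₀ > 0 at 0
and trapped set at energy E₀ reduced to {(0,0)}, one has V(x) < E₀ for all x ≠ 0: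
the maximum at 0 is strict and global. -/
theorem global_strict_maximum_of_trapped_set {n : ℕ} (hn : 1 < n)
    (V : EuclideanSpace ℝ (Fin n) → ℝ) (hV : ContDiff ℝ (⊤ : ℕ∞) V)
    (E₀ : ℝ) (hE₀ : 0 < E₀) (hV0 : V 0 = E₀)
    (ρ₀ C : ℝ) (hρ₀ : 1 < ρ₀)
    (hshort : ∀ x : EuclideanSpace ℝ (Fin n),
      |V x| ≤ C * (1 + ‖x‖) ^ (-ρ₀) ∧ ‖gradient V x‖ ≤ C * (1 + ‖x‖) ^ (-ρ₀ - 1))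
    (c r : ℝ) (hc : 0 < c) (hr : 0 < r)
    (hmax : ∀ x : EuclideanSpace ℝ (Fin n), ‖x‖ < r → V x ≤ E₀ - c * ‖x‖ ^ 2)
    (htrap : ∀ x ξ : ℝ → EuclideanSpace ℝ (Fin n),
      (∀ t, HasDerivAt x (ξ t) t) →
      (∀ t, HasDerivAt ξ (-(gradient V (x t))) t) →
      ‖ξ 0‖ ^ 2 / 2 + V (x 0) = E₀ →
      ¬ Tendsto (fun t => ‖x t‖) atTop atTop →
      ¬ Tendsto (fun t => ‖x t‖) atBot atTop →
      x 0 = 0 ∧ ξ 0 = 0) :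
    ∀ x : EuclideanSpace ℝ (Fin n), x ≠ 0 → V x < E₀ := by
  by_contra! hcon
  obtain ⟨p, hp0, hp⟩ := hcon
  have hC : E₀ ≤ C := by
    have := (hshort 0).1
    rw [hV0, norm_zero, add_zero, Real.one_rpow, mul_one] at this
    exact (le_abs_self _).trans this
  have hC0 : 0 < C := hE₀.trans_le hC
  have hdecay : ∀ x, |V x| ≤ C * (1 + ‖x‖)⁻¹ := fun x => by
    refine (hshort x).1.trans ?_
    rw [← Real.rpow_neg_one]
    gcongr
    linarith [norm_nonneg x]
  have hVC : ∀ x, |V x| ≤ C := fun x =>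
    (hdecay x).trans <| mul_le_of_le_one_right hC0.le <|
      inv_le_one_of_one_le₀ (by linarith [norm_nonneg x])
  have hpr : r ≤ ‖p‖ := by
    by_contra! h
    have := hmax p h
    have : 0 < c * ‖p‖ ^ 2 := by positivity
    linarith
  have hfar : ∀ x : EuclideanSpace ℝ (Fin n), 2 * C / E₀ < ‖x‖ → √E₀ ^ 2 / 2 ≤ E₀ - V x := by
    intro x hx
    have h1 := (le_abs_self _).trans (hdecay x)
    have h2 : C * (1 + ‖x‖)⁻¹ ≤ E₀ / 2 := by
      rw [div_lt_iff₀ hE₀] at hx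
      rw [← div_eq_mul_inv, div_le_iff₀ (by positivity)]
      nlinarith
    rw [Real.sq_sqrt hE₀.le]
    linarith
  obtain ⟨x, ξ, R, hx, hξ, hxL, hWx, hξ0, hR⟩ := exists_bounded_newton_orbit
    (W := fun x => E₀ - V x) (L := {x | r ≤ ‖x‖ ∧ E₀ ≤ V x}) (B := E₀ + C) (R₀ := 2 * C / E₀)
    (c := √E₀) (contDiff_const.sub hV)
    ((isClosed_le continuous_const continuous_norm).inter
      (isClosed_le continuous_const hV.continuous))
    (fun h => by simpa using hr.trans_le h.1)
    (fun x hx => by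
      rcases lt_or_ge ‖x‖ r with h | h
      · have := hmax x h
        have : 0 ≤ c * ‖x‖ ^ 2 := by positivity
        linarith
      · have : ¬ E₀ ≤ V x := fun h' => hx ⟨h, h'⟩
        linarith)
    (fun x hx => by linarith [hx.2]) (by simp [hV0])
    (fun x => by
      have := abs_sub E₀ (V x)
      rw [abs_of_pos hE₀] at this
      linarith [hVC x])
    ⟨p, hpr, hp⟩ (Real.sqrt_pos.2 hE₀) hfar
  have hgrad : ∀ y, gradient (fun x => E₀ - V x) y = -gradient V y := fun y => by
    simp [gradient, fderiv_const_sub]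
  have hbdd : ∀ l : Filter ℝ, l.NeBot → ¬ Tendsto (fun t => ‖x t‖) l atTop := fun l _ hl =>
    not_isBoundedUnder_of_tendsto_atTop hl (isBoundedUnder_of ⟨R, hR⟩)
  have h0 := (htrap x ξ hx (fun t => hgrad (x t) ▸ hξ t) (by rw [hξ0]; simp; linarith)
    (hbdd _ inferInstance) (hbdd _ inferInstance)).1
  have := hxL.1
  rw [h0, norm_zero] at this
  linarith
end

section
/- The phase function Φ(x,y,(t,θ)) = φ(t,x,θ) - y·θ + tE₀, with phase variables (t,θ) ∈ ℝ^{1+n}, is non-degenerate at every point of its critical set contained in a region where the Hamiltonian vector field H_p does not vanish on {p = E₀}. Specifically: if at a critical point (Φ'_t = 0, Φ'_θ = 0) the full gradient row (φ''_{tt}, φ''_{tθ}, φ''_{tx}) vanishes, then using the eikonal equation φ'_t + p(x,φ'_x) = 0 and the flow relation (x,φ'_x) = exp(tH_p)(φ'_θ, θ), one deduces H_p(y,θ) = 0 and p(y,θ) = E₀, a contradiction; hence the matrix (dΦ'_t ; dΦ'_θ) has maximal rank n+1. -/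
open scoped RealInnerProductSpace

section ODE

open Set Filter Topology
open scoped NNReal

variable {E : Type*} [NormedAddCommGroup E] [NormedSpace ℝ E]

/-- Exponential estimate for the distance between two integral curves of a vector field which is
Lipschitz on the unit neighbourhood of the first one. -/
lemma norm_sub_le_exp_of_integralCurve {H : E → E} {S : Set E} {κ : ℝ≥0}
    (hH : LipschitzOnWith κ H S) {T : ℝ} {γ δ : ℝ → E}
    (hγ : ∀ r, HasDerivAt γ (H (γ r)) r) (hδ : ∀ r, HasDerivAt δ (H (δ r)) r)
    (hS : ∀ r ∈ Icc 0 T, ∀ x, ‖x - γ r‖ ≤ 1 → x ∈ S)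
    {d : ℝ} (hd : 0 < d) (hdT : Real.exp ((κ + 1) * T) * d ≤ 1) (h0 : ‖δ 0 - γ 0‖ ≤ d) :
    ∀ r ∈ Icc 0 T, ‖δ r - γ r‖ ≤ Real.exp ((κ + 1) * T) * d := by
  have hmono : ∀ r ∈ Icc 0 T, Real.exp ((κ + 1) * r) * d ≤ Real.exp ((κ + 1) * T) * d := by
    intro r hr
    have := hr.2
    gcongr
  have hB : ∀ r : ℝ, HasDerivAt (fun r : ℝ => Real.exp ((κ + 1) * r) * d)
      (Real.exp ((κ + 1) * r) * (κ + 1) * d) r := fun r => by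
    simpa using (((hasDerivAt_id r).const_mul ((κ : ℝ) + 1)).exp).mul_const d
  have hf : ∀ r, HasDerivAt (fun r => δ r - γ r) (H (δ r) - H (γ r)) r :=
    fun r => (hδ r).sub (hγ r)
  intro r hr
  refine (image_norm_le_of_norm_deriv_right_lt_deriv_boundary
    (fun r _ => (hf r).continuousAt.continuousWithinAt)
    (fun r _ => (hf r).hasDerivWithinAt) (by simpa using h0) hB ?_ hr).trans (hmono r hr)
  intro x hx heq
  have hx' : x ∈ Icc 0 T := Ico_subset_Icc_self hx
  have hle : ‖δ x - γ x‖ ≤ 1 := heq.le.trans ((hmono x hx').trans hdT)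
  have hL := hH.norm_sub_le (hS x hx' _ hle) (hS x hx' (γ x) (by simp))
  have hpos : 0 < Real.exp ((κ + 1) * x) * d := by positivity
  calc ‖H (δ x) - H (γ x)‖ ≤ κ * ‖δ x - γ x‖ := hL
    _ < Real.exp ((κ + 1) * x) * (κ + 1) * d := by rw [heq]; nlinarith

variable [ProperSpace E]

lemma exists_norm_sub_le_of_integralCurve_forward {H : E → E} (hH : LocallyLipschitz H)
    {γ : ℝ → E} (hγ : ∀ r, HasDerivAt γ (H (γ r)) r) (T : ℝ) :
    ∃ C > 0, ∀ δ : ℝ → E, (∀ r, HasDerivAt δ (H (δ r)) r) → ∀ d > 0, C * d ≤ 1 →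
      ‖δ 0 - γ 0‖ ≤ d → ∀ r ∈ Icc 0 T, ‖δ r - γ r‖ ≤ C * d := by
  have hγc : Continuous γ := continuous_iff_continuousAt.2 fun r => (hγ r).continuousAt
  have hcomp : IsCompact (Metric.cthickening 1 (γ '' Icc 0 T)) :=
    (isCompact_Icc.image hγc).cthickening
  obtain ⟨κ, hκ⟩ := hH.locallyLipschitzOn.exists_lipschitzOnWith_of_compact hcomp
  refine ⟨_, Real.exp_pos ((κ + 1) * T), fun δ hδ d hd hdT h0 =>
    norm_sub_le_exp_of_integralCurve hκ hγ hδ ?_ hd hdT h0⟩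
  intro r hr x hx
  exact Metric.mem_cthickening_of_dist_le x (γ r) 1 _ (mem_image_of_mem γ hr)
    (by rwa [dist_eq_norm])

/-- Integral curves of a locally Lipschitz vector field depend in a Lipschitz way on their initial
value, uniformly on bounded time intervals. -/
lemma exists_norm_sub_le_of_integralCurve {H : E → E} (hH : LocallyLipschitz H)
    {γ : ℝ → E} (hγ : ∀ r, HasDerivAt γ (H (γ r)) r) (T : ℝ) :
    ∃ C > 0, ∀ δ : ℝ → E, (∀ r, HasDerivAt δ (H (δ r)) r) → ∀ d > 0, C * d ≤ 1 →
      ‖δ 0 - γ 0‖ ≤ d → ∀ r, |r| ≤ T → ‖δ r - γ r‖ ≤ C * d := by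
  have hrev : ∀ η : ℝ → E, (∀ r, HasDerivAt η (H (η r)) r) →
      ∀ r, HasDerivAt (fun r => η (-r)) ((fun x => -H x) (η (-r))) r := by
    intro η hη r
    simpa [Function.comp_def] using (hη (-r)).scomp r (hasDerivAt_neg r)
  have hH' : LocallyLipschitz fun x => -H x := hH.neg
  obtain ⟨C₁, hC₁, h₁⟩ := exists_norm_sub_le_of_integralCurve_forward hH hγ T
  obtain ⟨C₂, hC₂, h₂⟩ := exists_norm_sub_le_of_integralCurve_forward hH' (hrev γ hγ) T
  refine ⟨max C₁ C₂, lt_max_of_lt_left hC₁, fun δ hδ d hd hdT h0 r hr => ?_⟩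
  have hr' := abs_le.1 hr
  have hle₁ : C₁ * d ≤ max C₁ C₂ * d := by gcongr; exact le_max_left _ _
  have hle₂ : C₂ * d ≤ max C₁ C₂ * d := by gcongr; exact le_max_right _ _
  rcases le_total 0 r with h | h
  · exact (h₁ δ hδ d hd (hle₁.trans hdT) h0 r ⟨h, hr'.2⟩).trans hle₁
  · have := h₂ (fun r => δ (-r)) (hrev δ hδ) d hd (hle₂.trans hdT) (by simpa using h0) (-r)
      ⟨by linarith, by linarith⟩
    simp only [neg_neg] at this
    exact this.trans hle₂

/-- An integral curve of a locally Lipschitz vector field which meets a zero of the field is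
constant. -/
lemma integralCurve_eq_of_apply_eq_zero {H : E → E} (hH : LocallyLipschitz H) {γ : ℝ → E}
    (hγ : ∀ r, HasDerivAt γ (H (γ r)) r) {t : ℝ} (ht : H (γ t) = 0) (s : ℝ) : γ s = γ t := by
  have hγ' : ∀ r, HasDerivAt (fun r => γ (r + t)) (H (γ (r + t))) r :=
    fun r => (hγ (r + t)).comp_add_const r t
  obtain ⟨C, hC, h⟩ := exists_norm_sub_le_of_integralCurve hH hγ' |s - t|
  have key : ∀ d > 0, C * d ≤ 1 → ‖γ t - γ s‖ ≤ C * d := fun d hd hd1 => by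
    simpa using h (fun _ => γ t) (fun r => by simpa [ht] using hasDerivAt_const r (γ t)) d hd hd1
      (by simpa using hd.le) (s - t) le_rfl
  have hle : ‖γ t - γ s‖ ≤ 0 := by
    refine le_of_forall_pos_le_add fun ε hε => ?_
    have := key (min ε 1 / C) (by positivity) (by
      rw [mul_div_cancel₀ _ hC.ne']; exact min_le_right _ _)
    rw [mul_div_cancel₀ _ hC.ne'] at this
    simpa using this.trans (min_le_left _ _)
  exact (sub_eq_zero.1 (norm_le_zero_iff.1 hle)).symm

/-- Moving the initial point along a curve with vanishing velocity does not change the velocity of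
the flow line. -/
lemma hasDerivAt_flow_of_hasDerivAt_zero {H : E → E} (hH : LocallyLipschitz H)
    {flow : ℝ → E → E} (hflow0 : ∀ x, flow 0 x = x)
    (hflow : ∀ r x, HasDerivAt (fun s => flow s x) (H (flow r x)) r)
    {ρ : ℝ → E} {t : ℝ} (hρ : HasDerivAt ρ 0 t) :
    HasDerivAt (fun s => flow s (ρ s)) (H (flow t (ρ t))) t := by
  obtain ⟨C, hC, h⟩ := exists_norm_sub_le_of_integralCurve hH
    (fun r => hflow r (ρ t)) (|t| + 1)
  have hbound : ∀ᶠ s in 𝓝 t, ‖flow s (ρ s) - flow s (ρ t)‖ ≤ C * ‖ρ s - ρ t‖ := by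
    have hsmall : ∀ᶠ s in 𝓝 t, C * ‖ρ s - ρ t‖ < 1 := by
      have : ContinuousAt (fun s => C * ‖ρ s - ρ t‖) t :=
        continuousAt_const.mul (hρ.continuousAt.sub continuousAt_const).norm
      exact this.eventually_lt continuousAt_const (by simp)
    have htime : ∀ᶠ s in 𝓝 t, |s| < |t| + 1 :=
      continuous_abs.continuousAt.eventually_lt continuousAt_const (by simp)
    filter_upwards [hsmall, htime] with s hs hs'
    rcases eq_or_ne (ρ s) (ρ t) with heq | hne
    · simp [heq]
    · exact h (fun r => flow r (ρ s)) (fun r => hflow r (ρ s)) _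
        (norm_pos_iff.2 (sub_ne_zero.2 hne)) hs.le (by simp [hflow0]) s hs'.le
  have hlittle : (fun s => ρ s - ρ t) =o[𝓝 t] fun s => s - t := by
    simpa using hasDerivAt_iff_isLittleO.1 hρ
  have hdiff : HasDerivAt (fun s => flow s (ρ s) - flow s (ρ t)) 0 t := by
    rw [hasDerivAt_iff_isLittleO]
    simpa using (Asymptotics.IsBigO.of_bound C hbound).trans_isLittleO hlittle
  simpa [Pi.add_def] using hdiff.add (hflow t (ρ t))

end ODE

section Gradient

variable {A B F : Type*} [NormedAddCommGroup A] [NormedSpace ℝ A]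
  [NormedAddCommGroup F] [InnerProductSpace ℝ F] [CompleteSpace F]

/-- A partial gradient as the Riesz representative of the restricted total differential. -/
lemma gradient_comp_eq_toDual_symm {f : A → ℝ} {g : F → A} {x : F} {L : F →L[ℝ] A}
    (hf : DifferentiableAt ℝ f (g x)) (hg : HasFDerivAt g L x) :
    gradient (fun y => f (g y)) x =
      (InnerProductSpace.toDual ℝ F).symm ((fderiv ℝ f (g x)).comp L) := by
  have h : HasFDerivAt (fun y => f (g y)) ((fderiv ℝ f (g x)).comp L) x :=
    hf.hasFDerivAt.comp x hg
  rw [gradient, h.fderiv]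

end Gradient

/-- Non-degeneracy of the phase Φ(x,y,(t,θ)) = φ(t,x,θ) - y·θ + tE₀: at every critical
point (∂ₜΦ = 0, ∂_θΦ = 0) whose associated point (y,θ) = (∂_θφ, θ) lies in a set K on
which H_p does not vanish at energy E₀, the map G = (∂ₜΦ, ∂_θΦ) has surjective
differential, i.e. the matrix (dΦ'ₜ; dΦ'_θ) has maximal rank n+1. -/
theorem phase_function_nondegenerate {n : ℕ}
    (V : EuclideanSpace ℝ (Fin n) → ℝ) (hV : ContDiff ℝ (⊤ : ℕ∞) V)
    (E₀ : ℝ)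
    (flow : ℝ → EuclideanSpace ℝ (Fin n) × EuclideanSpace ℝ (Fin n) →
      EuclideanSpace ℝ (Fin n) × EuclideanSpace ℝ (Fin n))
    (hflow0 : ∀ ρ, flow 0 ρ = ρ)
    (hflowD : ∀ t ρ, HasDerivAt (fun s => flow s ρ)
      ((flow t ρ).2, -(gradient V (flow t ρ).1)) t)
    (φ : ℝ → EuclideanSpace ℝ (Fin n) → EuclideanSpace ℝ (Fin n) → ℝ)
    (hφ : ContDiff ℝ (⊤ : ℕ∞)
      (fun q : ℝ × EuclideanSpace ℝ (Fin n) × EuclideanSpace ℝ (Fin n) =>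
        φ q.1 q.2.1 q.2.2))
    (heik : ∀ t x θ, deriv (fun t' => φ t' x θ) t
      + (‖gradient (fun x' => φ t x' θ) x‖ ^ 2 / 2 + V x) = 0)
    (hrel : ∀ t x θ, (x, gradient (fun x' => φ t x' θ) x)
      = flow t (gradient (fun θ' => φ t x θ') θ, θ))
    (K : Set (EuclideanSpace ℝ (Fin n) × EuclideanSpace ℝ (Fin n)))
    (hK : ∀ ρ ∈ K, ‖ρ.2‖ ^ 2 / 2 + V ρ.1 = E₀ → ¬(ρ.2 = 0 ∧ gradient V ρ.1 = 0))
    (G : EuclideanSpace ℝ (Fin n) × EuclideanSpace ℝ (Fin n) × ℝ ×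
      EuclideanSpace ℝ (Fin n) → ℝ × EuclideanSpace ℝ (Fin n))
    (hG : ∀ z : EuclideanSpace ℝ (Fin n) × EuclideanSpace ℝ (Fin n) × ℝ ×
        EuclideanSpace ℝ (Fin n),
      G z = (deriv (fun t' => φ t' z.1 z.2.2.2) z.2.2.1 + E₀,
        gradient (fun θ' => φ z.2.2.1 z.1 θ') z.2.2.2 - z.2.1)) :
    ∀ z : EuclideanSpace ℝ (Fin n) × EuclideanSpace ℝ (Fin n) × ℝ ×
        EuclideanSpace ℝ (Fin n),
      G z = 0 →
      (gradient (fun θ' => φ z.2.2.1 z.1 θ') z.2.2.2, z.2.2.2) ∈ K →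
      Function.Surjective ⇑(fderiv ℝ G z) := by
  set Φ : ℝ × EuclideanSpace ℝ (Fin n) × EuclideanSpace ℝ (Fin n) → ℝ :=
    fun q => φ q.1 q.2.1 q.2.2
  have hΦd : Differentiable ℝ Φ := hφ.differentiable (by simp)
  have hΦd' : Differentiable ℝ (fderiv ℝ Φ) :=
    (hφ.fderiv_right (m := 1) (by norm_cast)).differentiable (by simp)
  let R := (InnerProductSpace.toDual ℝ (EuclideanSpace ℝ (Fin n))).symm
  let ιx : EuclideanSpace ℝ (Fin n) →L[ℝ]
      ℝ × EuclideanSpace ℝ (Fin n) × EuclideanSpace ℝ (Fin n) :=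
    (ContinuousLinearMap.inr ℝ _ _).comp (ContinuousLinearMap.inl ℝ _ _)
  let ιθ : EuclideanSpace ℝ (Fin n) →L[ℝ]
      ℝ × EuclideanSpace ℝ (Fin n) × EuclideanSpace ℝ (Fin n) :=
    (ContinuousLinearMap.inr ℝ _ _).comp (ContinuousLinearMap.inr ℝ _ _)
  have hdt : ∀ t x θ, deriv (fun t' => φ t' x θ) t = fderiv ℝ Φ (t, x, θ) (1, 0) := by
    intro t x θ
    exact ((hΦd (t, x, θ)).hasFDerivAt.comp_hasDerivAt t
      ((hasDerivAt_id t).prodMk (hasDerivAt_const t (x, θ)))).deriv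
  have hdx : ∀ t x θ, gradient (fun x' => φ t x' θ) x = R ((fderiv ℝ Φ (t, x, θ)).comp ιx) := by
    intro t x θ
    exact gradient_comp_eq_toDual_symm (f := Φ) (g := fun x' => (t, x', θ)) (hΦd _)
      ((hasFDerivAt_prodMk_right t (x, θ)).comp x (hasFDerivAt_prodMk_left x θ))
  have hdθ : ∀ t x θ, gradient (fun θ' => φ t x θ') θ = R ((fderiv ℝ Φ (t, x, θ)).comp ιθ) := by
    intro t x θ
    exact gradient_comp_eq_toDual_symm (f := Φ) (g := fun θ' => (t, x, θ')) (hΦd _)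
      ((hasFDerivAt_prodMk_right t (x, θ)).comp θ (hasFDerivAt_prodMk_right x θ))
  rintro ⟨x, y, t, θ⟩ hz hmem
  simp only at hmem
  set D := fderiv ℝ (fderiv ℝ Φ) (t, x, θ) with hD
  -- The full differential of `∂ₜφ` does not vanish.
  have hne : D (1, 0) ≠ 0 := by
    intro hD0
    have hcurve : HasDerivAt (fun s => fderiv ℝ Φ (s, x, θ)) 0 t := by
      have := (hΦd' (t, x, θ)).hasFDerivAt.comp_hasDerivAt t
        ((hasDerivAt_id t).prodMk (hasDerivAt_const t (x, θ)))
      rw [← hD, hD0] at this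
      exact this
    have hgrad : ∀ ι : EuclideanSpace ℝ (Fin n) →L[ℝ]
        ℝ × EuclideanSpace ℝ (Fin n) × EuclideanSpace ℝ (Fin n),
        HasDerivAt (fun s => R ((fderiv ℝ Φ (s, x, θ)).comp ι)) 0 t := by
      intro ι
      have h1 : HasDerivAt (fun s => (fderiv ℝ Φ (s, x, θ)).comp ι) 0 t := by
        simpa using hcurve.clm_comp (hasDerivAt_const t ι)
      have h2 := R.toContinuousLinearEquiv.toContinuousLinearMap.hasFDerivAt.comp_hasDerivAt t h1
      rw [map_zero] at h2
      exact h2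
    let H : EuclideanSpace ℝ (Fin n) × EuclideanSpace ℝ (Fin n) →
      EuclideanSpace ℝ (Fin n) × EuclideanSpace ℝ (Fin n) := fun ρ => (ρ.2, -(gradient V ρ.1))
    have hH : LocallyLipschitz H := by
      have hgV : ContDiff ℝ 1 (gradient V) :=
        R.toContinuousLinearEquiv.contDiff.comp (hV.fderiv_right (m := 1) (by norm_cast))
      exact (contDiff_snd.prodMk (hgV.comp contDiff_fst).neg).locallyLipschitz
    have hρ : HasDerivAt
        (fun s => (R ((fderiv ℝ Φ (s, x, θ)).comp ιθ), θ)) 0 t :=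
      (hgrad ιθ).prodMk (hasDerivAt_const t θ)
    have hflow := hasDerivAt_flow_of_hasDerivAt_zero (H := H) hH hflow0 hflowD hρ
    have hend : HasDerivAt
        (fun s => (x, R ((fderiv ℝ Φ (s, x, θ)).comp ιx))) 0 t :=
      (hasDerivAt_const t x).prodMk (hgrad ιx)
    have hrel' : ∀ s, flow s (R ((fderiv ℝ Φ (s, x, θ)).comp ιθ), θ) =
        (x, R ((fderiv ℝ Φ (s, x, θ)).comp ιx)) := by
      intro s
      rw [← hdθ, ← hdx, hrel]
    have hH0 : H (flow t (R ((fderiv ℝ Φ (t, x, θ)).comp ιθ), θ)) = 0 := by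
      refine hflow.unique ?_
      simpa only [hrel'] using hend
    have hfix := integralCurve_eq_of_apply_eq_zero hH
      (fun r => hflowD r (R ((fderiv ℝ Φ (t, x, θ)).comp ιθ), θ)) hH0 0
    simp only [hflow0] at hfix
    rw [← hfix] at hH0
    rw [hrel'] at hfix
    obtain ⟨hfix1, hfix2⟩ := Prod.mk.inj hfix
    have hen : deriv (fun t' => φ t' x θ) t + E₀ = 0 := by
      have := congrArg Prod.fst ((hG _).symm.trans hz)
      simpa using this
    have heik' := heik t x θ
    rw [hdx, ← hfix2] at heik'
    rw [hdθ] at hmem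
    refine hK _ hmem ?_ ⟨congrArg Prod.fst hH0, neg_eq_zero.1 (congrArg Prod.snd hH0)⟩
    simp only [hfix1]
    linarith
  -- Differentiate `G`.
  let P : EuclideanSpace ℝ (Fin n) × EuclideanSpace ℝ (Fin n) × ℝ × EuclideanSpace ℝ (Fin n) →L[ℝ]
      ℝ × EuclideanSpace ℝ (Fin n) × EuclideanSpace ℝ (Fin n) :=
    ((ContinuousLinearMap.fst ℝ _ _).comp
      ((ContinuousLinearMap.snd ℝ _ _).comp (ContinuousLinearMap.snd ℝ _ _))).prod
    ((ContinuousLinearMap.fst ℝ _ _).prod ((ContinuousLinearMap.snd ℝ _ _).comp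
      ((ContinuousLinearMap.snd ℝ _ _).comp (ContinuousLinearMap.snd ℝ _ _))))
  have hGeq : G = fun z => (fderiv ℝ Φ (P z) (1, 0) + E₀,
      R ((fderiv ℝ Φ (P z)).comp ιθ) - z.2.1) := by
    funext z
    rw [hG, hdt, hdθ]
    rfl
  have hDP : HasFDerivAt (fun z => fderiv ℝ Φ (P z)) (D.comp P) (x, y, t, θ) :=
    HasFDerivAt.comp (g := fderiv ℝ Φ) (x, y, t, θ) (hΦd' (t, x, θ)).hasFDerivAt P.hasFDerivAt
  have hG1 : HasFDerivAt (fun z => fderiv ℝ Φ (P z) (1, 0) + E₀)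
      ((D.comp P).flip (1, 0)) (x, y, t, θ) := by
    simpa using (hDP.clm_apply (hasFDerivAt_const ((1 : ℝ), (0 : EuclideanSpace ℝ (Fin n) ×
      EuclideanSpace ℝ (Fin n))) _)).add_const E₀
  have hM : ∃ M : EuclideanSpace ℝ (Fin n) × EuclideanSpace ℝ (Fin n) × ℝ ×
      EuclideanSpace ℝ (Fin n) →L[ℝ] EuclideanSpace ℝ (Fin n),
      HasFDerivAt (fun z => R ((fderiv ℝ Φ (P z)).comp ιθ)) M (x, y, t, θ) ∧
      ∀ v, M v = R ((D (P v)).comp ιθ) := by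
    have h1 := hDP.clm_comp (hasFDerivAt_const ιθ (x, y, t, θ))
    have h2 := R.toContinuousLinearEquiv.toContinuousLinearMap.hasFDerivAt.comp (x, y, t, θ) h1
    exact ⟨_, h2, fun v => by simp⟩
  obtain ⟨M, hM, hMapply⟩ := hM
  have hG' := hG1.prodMk (hM.sub
    ((ContinuousLinearMap.fst ℝ (EuclideanSpace ℝ (Fin n)) (ℝ × EuclideanSpace ℝ (Fin n))).comp
      (ContinuousLinearMap.snd ℝ (EuclideanSpace ℝ (Fin n)) _)).hasFDerivAt)
  rw [hGeq]
  have hfd := hG'.fderiv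
  have hsymm : IsSymmSndFDerivAt ℝ Φ (t, x, θ) :=
    hφ.contDiffAt.isSymmSndFDerivAt (by
      rw [minSmoothness_of_isRCLikeNormedField]
      exact WithTop.coe_le_coe.2 (le_top (a := (2 : ℕ∞))))
  obtain ⟨w, hw⟩ : ∃ w, D (1, 0) w ≠ 0 := by
    by_contra! h
    exact hne (ContinuousLinearMap.ext h)
  rintro ⟨a, b⟩
  let c := a / D (1, 0) w
  let v := c • w
  refine ⟨(v.2.1, R ((D v).comp ιθ) - b, v.1, v.2.2), ?_⟩
  refine (DFunLike.congr_fun hfd _).trans ?_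
  refine Prod.ext ?_ ?_
  · change D v (1, 0) = a
    rw [hD, hsymm.eq, ← hD, map_smul, smul_eq_mul, div_mul_cancel₀ _ hw]
  · change M _ - (R ((D v).comp ιθ) - b) = b
    rw [hMapply]
    change R ((D v).comp ιθ) - (R ((D v).comp ιθ) - b) = b
    abel
end
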